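/- arXiv:2002.05378 — 4 statements merged into one kernel-verified Lean document; each statement's English description precedes it below -/
import Mathlib

section
/- Let P̂ and Q̂ be probability mass functions on a finite set U, let γ ∈ [0,1), and let E_P, E_Q : U → ℝ≥0 satisfy (1−γ)·P̂(x) ≤ E_P(x) ≤ (1+γ)·P̂(x) and (1−γ)·Q̂(x) ≤ E_Q(x) ≤ (1+γ)·Q̂(x) for all x ∈ U. Then |Σ_{x∈U} ( 1[P̂(x) > Q̂(x)]·(1 − Q̂(x)/P̂(x)) − 1[E_P(x) > E_Q(x)]·(1 − E_Q(x)/E_P(x)) )·P̂(x)| ≤ 2γ/(1−γ). -/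
open Finset

lemma ite_one_sub_div_eq_max {p q : ℝ} (hp : 0 < p) :
    (if q < p then 1 - q / p else 0) = max 0 (1 - q / p) := by
  split_ifs with h
  · exact (max_eq_right (sub_nonneg.2 ((div_le_one hp).2 h.le))).symm
  · exact (max_eq_left (sub_nonpos.2 ((one_le_div hp).2 (not_lt.1 h)))).symm

/-- The truncation `t ↦ max 0 (1 - t)` changes by at most `2γ/(1-γ)` when its nonnegative argument
is perturbed by a factor between `(1-γ)/(1+γ)` and `(1+γ)/(1-γ)`. -/
lemma abs_max_one_sub_sub_le {r s γ : ℝ} (hγ0 : 0 ≤ γ) (hγ1 : γ < 1) (hs : 0 ≤ s)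
    (hlow : (1 - γ) * r ≤ (1 + γ) * s) (hupp : (1 - γ) * s ≤ (1 + γ) * r) :
    |max 0 (1 - r) - max 0 (1 - s)| ≤ 2 * γ / (1 - γ) := by
  have hγ : 0 < 1 - γ := sub_pos.2 hγ1
  rw [le_div_iff₀ hγ, ← abs_of_pos hγ, ← abs_mul, abs_le]
  rcases le_total r 1 with hr | hr <;> rcases le_total s 1 with hs1 | hs1
  · rw [max_eq_right (sub_nonneg.2 hr), max_eq_right (sub_nonneg.2 hs1)]
    constructor <;> nlinarith
  · rw [max_eq_right (sub_nonneg.2 hr), max_eq_left (sub_nonpos.2 hs1)]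
    constructor <;> nlinarith
  · rw [max_eq_left (sub_nonpos.2 hr), max_eq_right (sub_nonneg.2 hs1)]
    constructor <;> nlinarith
  · rw [max_eq_left (sub_nonpos.2 hr), max_eq_left (sub_nonpos.2 hs1)]
    constructor <;> linarith

/-- Error term B: for pmfs `P', Q'` on a finite set and multiplicative `(1 ± γ)`
approximations `E_P, E_Q` of them, the `P'`-weighted difference of the indicator ratio
expressions is at most `2γ/(1-γ)` in absolute value. -/
theorem indicator_ratio_error_bound {U : Type*} [Fintype U]
    (P' Q' E_P E_Q : U → ℝ) (γ : ℝ)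
    (hγ0 : 0 ≤ γ) (hγ1 : γ < 1)
    (hP'0 : ∀ x, 0 ≤ P' x) (hP'1 : ∑ x, P' x = 1)
    (hQ'0 : ∀ x, 0 ≤ Q' x) (hQ'1 : ∑ x, Q' x = 1)
    (hEP0 : ∀ x, 0 ≤ E_P x) (hEQ0 : ∀ x, 0 ≤ E_Q x)
    (hEP : ∀ x, (1 - γ) * P' x ≤ E_P x ∧ E_P x ≤ (1 + γ) * P' x)
    (hEQ : ∀ x, (1 - γ) * Q' x ≤ E_Q x ∧ E_Q x ≤ (1 + γ) * Q' x) :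
    |∑ x, ((if Q' x < P' x then 1 - Q' x / P' x else 0)
          - (if E_Q x < E_P x then 1 - E_Q x / E_P x else 0)) * P' x|
      ≤ 2 * γ / (1 - γ) := by
  have hγ : 0 < 1 - γ := sub_pos.2 hγ1
  calc _ ≤ ∑ x, 2 * γ / (1 - γ) * P' x := by
        refine (abs_sum_le_sum_abs _ _).trans (sum_le_sum fun x _ => ?_)
        rcases (hP'0 x).eq_or_lt with hp | hp
        · simp [← hp]
        have he : 0 < E_P x := (mul_pos hγ hp).trans_le (hEP x).1
        rw [abs_mul, abs_of_pos hp, ite_one_sub_div_eq_max hp, ite_one_sub_div_eq_max he]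
        refine mul_le_mul_of_nonneg_right
          (abs_max_one_sub_sub_le hγ0 hγ1 (div_nonneg (hEQ0 x) he.le) ?_ ?_) hp.le
        · rw [← mul_div_assoc, ← mul_div_assoc, div_le_div_iff₀ hp he]
          calc (1 - γ) * Q' x * E_P x ≤ E_Q x * ((1 + γ) * P' x) :=
                mul_le_mul (hEQ x).1 (hEP x).2 he.le (hEQ0 x)
            _ = (1 + γ) * E_Q x * P' x := by ring
        · rw [← mul_div_assoc, ← mul_div_assoc, div_le_div_iff₀ he hp]
          calc (1 - γ) * E_Q x * P' x = E_Q x * ((1 - γ) * P' x) := by ring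
            _ ≤ (1 + γ) * Q' x * E_P x :=
                mul_le_mul (hEQ x).2 (hEP x).1 (mul_pos hγ hp).le ((hEQ0 x).trans (hEQ x).2)
    _ = 2 * γ / (1 - γ) := by rw [← mul_sum, hP'1, mul_one]
end

section
/- Let P and Q be probability mass functions on a finite set U, let β ≥ 0 and γ ∈ [0,1), and let E_P be a (β,γ)-EVAL approximator for P and E_Q a (β,γ)-EVAL approximator for Q. Then | dTV(P,Q) − Σ_{x∈U} P(x)·1[E_P(x) > E_Q(x)]·(1 − E_Q(x)/E_P(x)) | ≤ 2γ/(1−γ) + 3β. -/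
open Finset

/-- The total variation distance is the total mass of the positive part of the difference. -/
lemma half_sum_abs_sub_eq_sum_max {U : Type*} [Fintype U] {P Q : U → ℝ}
    (h : ∑ x, P x = ∑ x, Q x) :
    (1 / 2) * (∑ x, |P x - Q x|) = ∑ x, max (P x - Q x) 0 := by
  have key : ∀ x, |P x - Q x| = 2 * max (P x - Q x) 0 - (P x - Q x) := fun x => by
    rcases le_total 0 (P x - Q x) with hx | hx
    · rw [abs_of_nonneg hx, max_eq_left hx]; ring
    · rw [abs_of_nonpos hx, max_eq_right hx]; ring
  simp_rw [key, Finset.sum_sub_distrib, ← Finset.mul_sum, h]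
  ring

/-- Expectations of a `[0,1]`-valued function differ by at most the total variation distance. -/
lemma abs_sum_mul_sub_sum_mul_le {U : Type*} [Fintype U] {P Q f : U → ℝ}
    (h : ∑ x, P x = ∑ x, Q x) (hf0 : ∀ x, 0 ≤ f x) (hf1 : ∀ x, f x ≤ 1) :
    |∑ x, P x * f x - ∑ x, Q x * f x| ≤ (1 / 2) * ∑ x, |P x - Q x| := by
  have e : ∑ x, P x * f x - ∑ x, Q x * f x = ∑ x, (P x - Q x) * (f x - 1 / 2) := by
    simp only [sub_mul, mul_sub, Finset.sum_sub_distrib, ← Finset.sum_mul, h]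
    ring
  rw [e, Finset.mul_sum]
  refine (Finset.abs_sum_le_sum_abs _ _).trans (Finset.sum_le_sum fun x _ => ?_)
  rw [abs_mul, mul_comm]
  refine mul_le_mul_of_nonneg_right ?_ (abs_nonneg _)
  rw [abs_le]
  constructor <;> linarith [hf0 x, hf1 x]

/-- Replacing both arguments perturbs the `ℓ¹` distance by at most the sum of the
perturbations. -/
lemma abs_sum_abs_sub_sub_sum_abs_sub_le {U : Type*} [Fintype U] (P Q P' Q' : U → ℝ) :
    |(∑ x, |P x - Q x|) - (∑ x, |P' x - Q' x|)| ≤ (∑ x, |P x - P' x|) + ∑ x, |Q x - Q' x| := by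
  rw [← Finset.sum_sub_distrib, ← Finset.sum_add_distrib]
  refine (Finset.abs_sum_le_sum_abs _ _).trans (Finset.sum_le_sum fun x _ => ?_)
  calc |(|P x - Q x| - |P' x - Q' x|)| ≤ |(P x - Q x) - (P' x - Q' x)| :=
        abs_abs_sub_abs_le_abs_sub _ _
    _ = |(P x - P' x) - (Q x - Q' x)| := by congr 1; ring
    _ ≤ _ := abs_sub _ _

lemma ite_one_sub_div_nonneg {a b : ℝ} (hb : 0 ≤ b) :
    0 ≤ (if b < a then 1 - b / a else 0) := by
  split_ifs with h
  · exact sub_nonneg.2 ((div_le_one (hb.trans_lt h)).2 h.le)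
  · exact le_rfl

lemma ite_one_sub_div_le_one {a b : ℝ} (hb : 0 ≤ b) :
    (if b < a then 1 - b / a else 0) ≤ 1 := by
  split_ifs with h
  · exact sub_le_self _ (div_nonneg hb (hb.trans h.le))
  · exact zero_le_one

/-- Multiplicative `(1 ± γ)`-approximations `a` of `p` and `b` of `q` estimate the positive part
of `p - q` up to an error proportional to `q`. -/
lemma abs_max_sub_sub_mul_ite_le {p q a b γ : ℝ} (hγ0 : 0 ≤ γ) (hγ1 : γ < 1)
    (hp : 0 ≤ p) (hq : 0 ≤ q) (ha1 : (1 - γ) * p ≤ a) (ha2 : a ≤ (1 + γ) * p)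
    (hb1 : (1 - γ) * q ≤ b) (hb2 : b ≤ (1 + γ) * q) :
    |max (p - q) 0 - p * (if b < a then 1 - b / a else 0)| ≤ 2 * γ / (1 - γ) * q := by
  have hγ : 0 < 1 - γ := sub_pos.2 hγ1
  rcases hp.eq_or_lt with rfl | hp
  · rw [zero_sub, max_eq_right (neg_nonpos.2 hq), zero_mul, sub_zero, abs_zero]
    positivity
  have ha : 0 < a := (mul_pos hγ hp).trans_le ha1
  have e : p * (if b < a then 1 - b / a else 0) = max (p - p * (b / a)) 0 := by
    split_ifs with h
    · have : b / a ≤ 1 := (div_le_one ha).2 h.le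
      rw [max_eq_left (by nlinarith)]; ring
    · have : 1 ≤ b / a := (one_le_div ha).2 (not_lt.1 h)
      rw [max_eq_right (by nlinarith), mul_zero]
  rw [e]
  refine (abs_max_sub_max_le_abs _ _ _).trans ?_
  have e2 : p - q - (p - p * (b / a)) = (p * b - q * a) / a := by field_simp; ring
  rw [e2, abs_div, abs_of_pos ha, div_le_iff₀ ha, div_mul_eq_mul_div, div_mul_eq_mul_div,
    le_div_iff₀ hγ]
  have h1 : p * b ≤ p * ((1 + γ) * q) := mul_le_mul_of_nonneg_left hb2 hp.le
  have h2 : p * ((1 - γ) * q) ≤ p * b := mul_le_mul_of_nonneg_left hb1 hp.le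
  have h3 : q * ((1 - γ) * p) ≤ q * a := mul_le_mul_of_nonneg_left ha1 hq
  have h4 : q * a ≤ q * ((1 + γ) * p) := mul_le_mul_of_nonneg_left ha2 hq
  have h5 : |p * b - q * a| ≤ 2 * γ * (p * q) := by
    rw [abs_le]; constructor <;> linarith
  nlinarith [mul_le_mul_of_nonneg_right h5 hγ.le, mul_le_mul_of_nonneg_left h3 hγ0]

/-- If `E_P` and `E_Q` are `(β,γ)`-EVAL approximators for pmfs `P` and `Q` on a finite set,
then `|dTV(P,Q) - ∑ x, P x * 1[E_P x > E_Q x] * (1 - E_Q x / E_P x)| ≤ 2γ/(1-γ) + 3β`. -/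
theorem tv_estimator_bias_bound {U : Type*} [Fintype U]
    (P Q E_P E_Q : U → ℝ) (β γ : ℝ)
    (hβ : 0 ≤ β) (hγ0 : 0 ≤ γ) (hγ1 : γ < 1)
    (hP0 : ∀ x, 0 ≤ P x) (hP1 : ∑ x, P x = 1)
    (hQ0 : ∀ x, 0 ≤ Q x) (hQ1 : ∑ x, Q x = 1)
    (hEP0 : ∀ x, 0 ≤ E_P x) (hEQ0 : ∀ x, 0 ≤ E_Q x)
    (hEP : ∃ P' : U → ℝ, (∀ x, 0 ≤ P' x) ∧ (∑ x, P' x = 1) ∧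
        (1 / 2) * (∑ x, |P x - P' x|) ≤ β ∧
        ∀ x, (1 - γ) * P' x ≤ E_P x ∧ E_P x ≤ (1 + γ) * P' x)
    (hEQ : ∃ Q' : U → ℝ, (∀ x, 0 ≤ Q' x) ∧ (∑ x, Q' x = 1) ∧
        (1 / 2) * (∑ x, |Q x - Q' x|) ≤ β ∧
        ∀ x, (1 - γ) * Q' x ≤ E_Q x ∧ E_Q x ≤ (1 + γ) * Q' x) :
    |(1 / 2) * (∑ x, |P x - Q x|)
        - ∑ x, P x * (if E_Q x < E_P x then 1 - E_Q x / E_P x else 0)|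
      ≤ 2 * γ / (1 - γ) + 3 * β := by
  obtain ⟨P', hP'0, hP'1, hPP', hE⟩ := hEP
  obtain ⟨Q', hQ'0, hQ'1, hQQ', hF⟩ := hEQ
  have h1 := abs_sum_abs_sub_sub_sum_abs_sub_le P Q P' Q'
  have h2 := abs_sum_mul_sub_sum_mul_le (hP1.trans hP'1.symm)
    (fun x => ite_one_sub_div_nonneg (a := E_P x) (hEQ0 x))
    (fun x => ite_one_sub_div_le_one (a := E_P x) (hEQ0 x))
  have h3 : |(1 / 2) * (∑ x, |P' x - Q' x|)
      - ∑ x, P' x * (if E_Q x < E_P x then 1 - E_Q x / E_P x else 0)| ≤ 2 * γ / (1 - γ) := by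
    rw [half_sum_abs_sub_eq_sum_max (hP'1.trans hQ'1.symm), ← Finset.sum_sub_distrib]
    calc _ ≤ ∑ x, 2 * γ / (1 - γ) * Q' x :=
          (Finset.abs_sum_le_sum_abs _ _).trans (Finset.sum_le_sum fun x _ =>
            abs_max_sub_sub_mul_ite_le hγ0 hγ1 (hP'0 x) (hQ'0 x) (hE x).1 (hE x).2
              (hF x).1 (hF x).2)
      _ = 2 * γ / (1 - γ) := by rw [← Finset.mul_sum, hQ'1, mul_one]
  rw [abs_le] at h1 h2 h3 ⊢
  constructor <;> linarith
end

section
/- Let P and Q be probability mass functions on a finite set U, let β ≥ 0, γ ∈ [0,1), ε > 0, δ ∈ (0,1), and let E_P be a (β,γ)-EVAL approximator for P and E_Q a (β,γ)-EVAL approximator for Q. Define g : U → [0,1] by g(x) = 1[E_P(x) > E_Q(x)]·(1 − E_Q(x)/E_P(x)). If m is a positive integer with m ≥ ln(2/δ)/(2ε²), then under the m-fold product measure P^{⊗m} on U^m, with probability at least 1 − δ the empirical average (1/m)·Σ_{i=1}^m g(x_i) of an i.i.d. sample x_1,…,x_m from P satisfies | (1/m)·Σ_{i=1}^m g(x_i)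 − dTV(P,Q) | ≤ 2γ/(1−γ) + 3β + ε. -/
open Finset

/-- **Hoeffding's lemma** for a weighted finite sum. -/
lemma sum_mul_exp_sub_mean_le {U : Type*} [Fintype U] (P g : U → ℝ)
    (hP0 : ∀ x, 0 ≤ P x) (hP1 : ∑ x, P x = 1) (hg : ∀ x, g x ∈ Set.Icc (0 : ℝ) 1) (t : ℝ) :
    ∑ x, P x * Real.exp (t * (g x - ∑ y, P y * g y)) ≤ Real.exp (t ^ 2 / 8) := by
  let _ : MeasurableSpace U := ⊤
  let p : PMF U := PMF.ofFintype (fun x => ENNReal.ofReal (P x)) (by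
    rw [← ENNReal.ofReal_sum_of_nonneg fun x _ => hP0 x, hP1, ENNReal.ofReal_one])
  have integral_eq (f : U → ℝ) : ∫ x, f x ∂p.toMeasure = ∑ x, P x * f x := by
    rw [PMF.integral_eq_sum]
    simp [p, hP0]
  have hsub := ProbabilityTheory.hasSubgaussianMGF_of_mem_Icc (μ := p.toMeasure) (X := g)
    (measurable_of_countable g).aemeasurable (Filter.Eventually.of_forall hg)
  have hmgf := hsub.mgf_le t
  rw [ProbabilityTheory.mgf, integral_eq, integral_eq] at hmgf
  refine hmgf.trans_eq ?_
  congr 1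
  norm_num
  ring

/-- **Hoeffding's inequality** for the product of finitely supported weights. -/
lemma sum_filter_abs_mean_sub_gt_le {U : Type*} [Fintype U] (P g : U → ℝ)
    (hP0 : ∀ x, 0 ≤ P x) (hP1 : ∑ x, P x = 1) (hg : ∀ x, g x ∈ Set.Icc (0 : ℝ) 1)
    {m : ℕ} (hm : 0 < m) {ε : ℝ} (hε : 0 < ε) :
    ∑ x : Fin m → U with ε < |(1 / (m : ℝ)) * (∑ i, g (x i)) - ∑ y, P y * g y|, ∏ i, P (x i)
      ≤ 2 * Real.exp (-(2 * m * ε ^ 2)) := by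
  have hm' : (0 : ℝ) < m := Nat.cast_pos.2 hm
  set μ := ∑ y, P y * g y with hμ
  have chernoff (t : ℝ) (ht : t ^ 2 = 16 * ε ^ 2) :
      ∑ x : Fin m → U, (∏ i, P (x i)) * Real.exp (t * ((∑ i, g (x i)) - m * μ) - 4 * m * ε ^ 2)
        ≤ Real.exp (-(2 * m * ε ^ 2)) := by
    have hprod (x : Fin m → U) :
        (∏ i, P (x i)) * Real.exp (t * ((∑ i, g (x i)) - m * μ) - 4 * m * ε ^ 2)
          = Real.exp (-(4 * m * ε ^ 2)) * ∏ i, P (x i) * Real.exp (t * (g (x i) - μ)) := by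
      rw [Finset.prod_mul_distrib, ← Real.exp_sum, ← Finset.mul_sum, Finset.sum_sub_distrib,
        sub_eq_add_neg, Real.exp_add]
      simp
      ring
    simp_rw [hprod]
    rw [← Finset.mul_sum, ← Fintype.sum_pow (fun u => P u * Real.exp (t * (g u - μ)))]
    calc Real.exp (-(4 * m * ε ^ 2)) * (∑ u, P u * Real.exp (t * (g u - μ))) ^ m
        ≤ Real.exp (-(4 * m * ε ^ 2)) * Real.exp (t ^ 2 / 8) ^ m := by
          gcongr
          · exact Finset.sum_nonneg fun u _ => mul_nonneg (hP0 u) (Real.exp_pos _).le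
          · exact sum_mul_exp_sub_mean_le P g hP0 hP1 hg t
      _ = Real.exp (-(2 * m * ε ^ 2)) := by
          rw [← Real.exp_nat_mul, ← Real.exp_add, ht]
          congr 1
          ring
  have hpos := chernoff (4 * ε) (by ring)
  have hneg := chernoff (-(4 * ε)) (by ring)
  refine le_trans ?_ ((add_le_add hpos hneg).trans_eq (two_mul _).symm)
  rw [← Finset.sum_add_distrib]
  refine (Finset.sum_le_sum fun x hx => ?_).trans
    (Finset.sum_le_sum_of_subset_of_nonneg (Finset.filter_subset _ _) fun x _ _ => ?_)
  · rw [← mul_add]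
    refine le_mul_of_one_le_right (Finset.prod_nonneg fun i _ => hP0 _) ?_
    have hx := (Finset.mem_filter.1 hx).2
    have hscale : (1 / (m : ℝ)) * (∑ i, g (x i)) - μ = ((∑ i, g (x i)) - m * μ) / m := by
      field_simp
    rw [hscale, abs_div, abs_of_pos hm', lt_div_iff₀ hm', lt_abs] at hx
    rcases hx with hx | hx
    · have := Real.one_le_exp (x := 4 * ε * ((∑ i, g (x i)) - m * μ) - 4 * m * ε ^ 2)
        (by nlinarith)
      have := Real.exp_pos (-(4 * ε) * ((∑ i, g (x i)) - m * μ) - 4 * m * ε ^ 2)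
      linarith
    · have := Real.one_le_exp (x := -(4 * ε) * ((∑ i, g (x i)) - m * μ) - 4 * m * ε ^ 2)
        (by nlinarith)
      have := Real.exp_pos (4 * ε * ((∑ i, g (x i)) - m * μ) - 4 * m * ε ^ 2)
      linarith
  · have : 0 ≤ ∏ i, P (x i) := Finset.prod_nonneg fun i _ => hP0 _
    positivity

/-- The positive part of `1 - b / a`, with value `0` when `a = 0` and `b` is nonnegative. -/
noncomputable def relativeExcess (a b : ℝ) : ℝ := if b < a then 1 - b / a else 0

lemma relativeExcess_mem_Icc {a b : ℝ} (hb : 0 ≤ b) : relativeExcess a b ∈ Set.Icc (0 : ℝ) 1 := by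
  unfold relativeExcess
  split_ifs with h
  · have ha : 0 < a := hb.trans_lt h
    have h1 : b / a ≤ 1 := (div_le_one ha).2 h.le
    have h2 : 0 ≤ b / a := by positivity
    constructor <;> linarith
  · simp

lemma mul_relativeExcess {a b : ℝ} (hb : 0 ≤ b) :
    a * relativeExcess a b = (|a - b| + (a - b)) / 2 := by
  unfold relativeExcess
  split_ifs with h
  · have ha : 0 < a := hb.trans_lt h
    rw [abs_of_pos (sub_pos.2 h)]
    field_simp
    ring
  · rw [abs_of_nonpos (by linarith)]
    ring

lemma relativeExcess_eq {a b : ℝ} (ha : 0 < a) : relativeExcess a b = 1 - min 1 (b / a) := by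
  unfold relativeExcess
  split_ifs with h
  · rw [min_eq_right ((div_le_one ha).2 h.le)]
  · rw [min_eq_left ((one_le_div ha).2 (not_lt.1 h)), sub_self]

lemma min_one_sub_min_one_le {r s c : ℝ} (hc : 1 ≤ c) (h : r ≤ c * s) :
    min 1 r - min 1 s ≤ c - 1 := by
  rcases le_total 1 s with hs | hs
  · rw [min_eq_left hs]
    linarith [min_le_left 1 r]
  · rw [min_eq_right hs]
    nlinarith [min_le_right 1 r]

/-- `relativeExcess` is stable under multiplicative perturbations of its arguments. -/
lemma abs_relativeExcess_sub_le {a b a' b' γ : ℝ} (hγ0 : 0 ≤ γ) (hγ1 : γ < 1)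
    (ha' : 0 ≤ a') (hb' : 0 ≤ b')
    (ha : (1 - γ) * a' ≤ a ∧ a ≤ (1 + γ) * a') (hb : (1 - γ) * b' ≤ b ∧ b ≤ (1 + γ) * b') :
    |relativeExcess a b - relativeExcess a' b'| ≤ 2 * γ / (1 - γ) := by
  have hγ : 0 < 1 - γ := sub_pos.2 hγ1
  have hb0 : 0 ≤ b := (mul_nonneg hγ.le hb').trans hb.1
  rcases ha'.eq_or_lt with rfl | ha'
  · have ha : a = 0 := by linarith
    have hnn : 0 ≤ 2 * γ / (1 - γ) := by positivity
    simpa [relativeExcess, ha, hb0.not_gt, hb'.not_gt] using hnn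
  have ha0 : 0 < a := (mul_pos hγ ha').trans_le ha.1
  have hc : (1 + γ) / (1 - γ) - 1 = 2 * γ / (1 - γ) := by
    field_simp
    ring
  have hc1 : 1 ≤ (1 + γ) / (1 - γ) := (one_le_div hγ).2 (by linarith)
  rw [relativeExcess_eq ha0, relativeExcess_eq ha', ← hc, abs_le]
  have h1 : b / a ≤ (1 + γ) / (1 - γ) * (b' / a') := by
    rw [div_mul_div_comm]
    exact div_le_div₀ (by positivity) hb.2 (by positivity) ha.1
  have h2 : b' / a' ≤ (1 + γ) / (1 - γ) * (b / a) := by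
    rw [div_mul_div_comm, div_le_div_iff₀ ha' (by positivity)]
    nlinarith [mul_le_mul ha.2 hb.1 (by positivity) (by positivity)]
  have := min_one_sub_min_one_le hc1 h1
  have := min_one_sub_min_one_le hc1 h2
  constructor <;> linarith

lemma abs_sum_sub_mul_le {U : Type*} [Fintype U] (P P' h : U → ℝ)
    (hPP' : ∑ x, P x = ∑ x, P' x) (hh : ∀ x, h x ∈ Set.Icc (0 : ℝ) 1) :
    |∑ x, (P x - P' x) * h x| ≤ (1 / 2) * ∑ x, |P x - P' x| := by
  have hshift : ∑ x, (P x - P' x) * h x = ∑ x, (P x - P' x) * (h x - 1 / 2) := by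
    simp_rw [mul_sub]
    rw [Finset.sum_sub_distrib, ← Finset.sum_mul, Finset.sum_sub_distrib, hPP']
    ring
  rw [hshift, Finset.mul_sum]
  refine (Finset.abs_sum_le_sum_abs _ _).trans (Finset.sum_le_sum fun x _ => ?_)
  rw [abs_mul, mul_comm]
  refine mul_le_mul_of_nonneg_right (abs_le.2 ?_) (abs_nonneg _)
  constructor <;> linarith [(hh x).1, (hh x).2]

lemma sum_mul_relativeExcess {U : Type*} [Fintype U] (P Q : U → ℝ)
    (hPQ : ∑ x, P x = ∑ x, Q x) (hQ0 : ∀ x, 0 ≤ Q x) :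
    ∑ x, P x * relativeExcess (P x) (Q x) = (1 / 2) * ∑ x, |P x - Q x| := by
  simp_rw [fun x => mul_relativeExcess (a := P x) (hQ0 x)]
  rw [← Finset.sum_div, Finset.sum_add_distrib, Finset.sum_sub_distrib, hPQ]
  ring

lemma abs_half_sum_abs_sub_sub_le {U : Type*} [Fintype U] (P Q P' Q' : U → ℝ) :
    |(1 / 2) * (∑ x, |P' x - Q' x|) - (1 / 2) * (∑ x, |P x - Q x|)|
      ≤ (1 / 2) * (∑ x, |P x - P' x|) + (1 / 2) * ∑ x, |Q x - Q' x| := by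
  rw [← mul_sub, ← mul_add, ← Finset.sum_sub_distrib, ← Finset.sum_add_distrib, abs_mul,
    abs_of_pos one_half_pos]
  refine mul_le_mul_of_nonneg_left ?_ one_half_pos.le
  refine (Finset.abs_sum_le_sum_abs _ _).trans (Finset.sum_le_sum fun x _ => ?_)
  calc |(|P' x - Q' x| - |P x - Q x|)| ≤ |P' x - Q' x - (P x - Q x)| := abs_abs_sub_abs_le _ _
    _ = |(Q x - Q' x) - (P x - P' x)| := by congr 1; ring
    _ ≤ |Q x - Q' x| + |P x - P' x| := abs_sub _ _
    _ = _ := add_comm _ _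

/-- Distance approximation from EVAL approximators: given `(β,γ)`-EVAL approximators
`E_P, E_Q` for pmfs `P, Q` on a finite set, and `m ≥ ln(2/δ)/(2ε²)` i.i.d. samples from `P`,
with probability at least `1 - δ` (under the `m`-fold product of `P`) the empirical average
of `g(x) = 1[E_P x > E_Q x] * (1 - E_Q x / E_P x)` is within `2γ/(1-γ) + 3β + ε` of
`dTV(P,Q)`. -/
theorem tv_estimation_from_eval_approximators {U : Type*} [Fintype U]
    (P Q E_P E_Q : U → ℝ) (β γ ε δ : ℝ) (m : ℕ)
    (hβ : 0 ≤ β) (hγ0 : 0 ≤ γ) (hγ1 : γ < 1)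
    (hε : 0 < ε) (hδ0 : 0 < δ) (hδ1 : δ < 1)
    (hP0 : ∀ x, 0 ≤ P x) (hP1 : ∑ x, P x = 1)
    (hQ0 : ∀ x, 0 ≤ Q x) (hQ1 : ∑ x, Q x = 1)
    (hEP0 : ∀ x, 0 ≤ E_P x) (hEQ0 : ∀ x, 0 ≤ E_Q x)
    (hEP : ∃ P' : U → ℝ, (∀ x, 0 ≤ P' x) ∧ (∑ x, P' x = 1) ∧
        (1 / 2) * (∑ x, |P x - P' x|) ≤ β ∧
        ∀ x, (1 - γ) * P' x ≤ E_P x ∧ E_P x ≤ (1 + γ) * P' x)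
    (hEQ : ∃ Q' : U → ℝ, (∀ x, 0 ≤ Q' x) ∧ (∑ x, Q' x = 1) ∧
        (1 / 2) * (∑ x, |Q x - Q' x|) ≤ β ∧
        ∀ x, (1 - γ) * Q' x ≤ E_Q x ∧ E_Q x ≤ (1 + γ) * Q' x)
    (hm : 0 < m) (hm2 : Real.log (2 / δ) / (2 * ε ^ 2) ≤ (m : ℝ)) :
    (1 : ℝ) - δ ≤
      ∑ x ∈ Finset.univ.filter (fun x : Fin m → U =>
          |(1 / (m : ℝ)) *
              (∑ i, if E_Q (x i) < E_P (x i) then 1 - E_Q (x i) / E_P (x i) else 0)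
            - (1 / 2) * (∑ y, |P y - Q y|)| ≤ 2 * γ / (1 - γ) + 3 * β + ε),
        ∏ i, P (x i) := by
  obtain ⟨P', hP'0, hP'1, hPβ, hPγ⟩ := hEP
  obtain ⟨Q', hQ'0, hQ'1, hQβ, hQγ⟩ := hEQ
  let g : U → ℝ := fun x => relativeExcess (E_P x) (E_Q x)
  let h : U → ℝ := fun x => relativeExcess (P' x) (Q' x)
  have hg (x : U) : g x ∈ Set.Icc (0 : ℝ) 1 := relativeExcess_mem_Icc (hEQ0 x)
  have hh (x : U) : h x ∈ Set.Icc (0 : ℝ) 1 := relativeExcess_mem_Icc (hQ'0 x)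
  have hbias : |(∑ y, P y * g y) - (1 / 2) * (∑ y, |P y - Q y|)| ≤ 2 * γ / (1 - γ) + 3 * β := by
    have hgh : |∑ y, P y * (g y - h y)| ≤ 2 * γ / (1 - γ) := by
      calc |∑ y, P y * (g y - h y)| ≤ ∑ y, |P y * (g y - h y)| := Finset.abs_sum_le_sum_abs _ _
        _ ≤ ∑ y, P y * (2 * γ / (1 - γ)) := by
            refine Finset.sum_le_sum fun y _ => ?_
            rw [abs_mul, abs_of_nonneg (hP0 y)]
            exact mul_le_mul_of_nonneg_left (abs_relativeExcess_sub_le hγ0 hγ1 (hP'0 y) (hQ'0 y)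
              (hPγ y) (hQγ y)) (hP0 y)
        _ = 2 * γ / (1 - γ) := by rw [← Finset.sum_mul, hP1, one_mul]
    have hPP' := (abs_sum_sub_mul_le P P' h (hP1.trans hP'1.symm) hh).trans hPβ
    have htv := abs_half_sum_abs_sub_sub_le P Q P' Q'
    have hP'h : ∑ y, P' y * h y = (1 / 2) * ∑ y, |P' y - Q' y| :=
      sum_mul_relativeExcess P' Q' (hP'1.trans hQ'1.symm) hQ'0
    simp only [mul_sub, sub_mul, Finset.sum_sub_distrib] at hgh hPP'
    rw [abs_le] at hgh hPP' htv ⊢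
    constructor <;> linarith
  have hexp : 2 * Real.exp (-(2 * m * ε ^ 2)) ≤ δ := by
    rw [div_le_iff₀ (by positivity)] at hm2
    have hle : Real.exp (-(2 * m * ε ^ 2)) ≤ Real.exp (-Real.log (2 / δ)) :=
      Real.exp_le_exp.2 (by linarith)
    rw [Real.exp_neg (Real.log _), Real.exp_log (by positivity), inv_div] at hle
    linarith
  have hbad := (sum_filter_abs_mean_sub_gt_le P g hP0 hP1 hg hm hε).trans hexp
  have htotal : ∑ x : Fin m → U, ∏ i, P (x i) = 1 := by
    rw [← Fintype.sum_pow, hP1, one_pow]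
  have hsplit := Finset.sum_filter_add_sum_filter_not Finset.univ
    (fun x : Fin m → U => ε < |(1 / (m : ℝ)) * (∑ i, g (x i)) - ∑ y, P y * g y|)
    (fun x => ∏ i, P (x i))
  rw [htotal] at hsplit
  refine le_trans (by linarith) (Finset.sum_le_sum_of_subset_of_nonneg
    (Finset.monotone_filter_right _ fun x _ hx => ?_)
    fun x _ _ => Finset.prod_nonneg fun i _ => hP0 _)
  exact (abs_sub_le _ (∑ y, P y * g y) _).trans
    ((add_le_add (not_lt.1 hx) hbias).trans_eq (add_comm _ _))
end

section
/- Let P and Q be Bayesian networks over the same directed acyclic graph structure, i.e., joint probability mass functions on (Fin n → Σ) of the form P(x) = Π_{i<n} p_i(x|_{pa(i)})(x_i) and Q(x) = Π_{i<n} q_i(x|_{pa(i)})(x_i), where pa(i) ⊆ {0,…,i−1} for each i and each p_i(a), q_i(a) is a probability mass function on Σ. Assume every q_i(a) has full support. Then KL(P,Q) = Σ_{i<n} Σ_{a : pa(i)→Σ} P( { x : x|_{pa(i)} = a } ) · KL( p_i(a), q_i(a) ). -/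
open Finset

/-- Resampling one coordinate uniformly: each point is hit `Fintype.card A` times. -/
theorem sum_sum_update {ι A : Type*} [Fintype ι] [DecidableEq ι] [Fintype A]
    (i : ι) (F : (ι → A) → ℝ) :
    ∑ x : ι → A, ∑ s, F (Function.update x i s) = Fintype.card A * ∑ x, F x := by
  classical
  have hinv : Function.Involutive
      (fun z : (ι → A) × A => (Function.update z.1 i z.2, z.1 i)) := by
    rintro ⟨x, s⟩
    simp
  calc ∑ x : ι → A, ∑ s, F (Function.update x i s)
      = ∑ z : (ι → A) × A, F (Function.update z.1 i z.2) :=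
        (Fintype.sum_prod_type' fun x s => F (Function.update x i s)).symm
    _ = ∑ z : (ι → A) × A, F z.1 := Equiv.sum_comp hinv.toPerm fun z => F z.1
    _ = Fintype.card A * ∑ x, F x := by
        rw [Fintype.sum_prod_type, mul_sum]
        simp

section BayesNet

variable {n : ℕ} {A : Type*} {pa : Fin n → Finset (Fin n)}

/-- A local factor at vertex `i` depends only on the vertices below `k`, for `i < k`. -/
theorem dependsOn_local (hpa : ∀ i, ∀ j ∈ pa i, j < i) {β : Type*} (i : Fin n)
    (g : ({j // j ∈ pa i} → A) → A → β) {k : ℕ} (hk : i.val < k) :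
    DependsOn (fun x : Fin n → A => g (fun j => x j.1) (x i)) {j | j.val < k} := by
  intro x y h
  have h1 : (fun j : {j // j ∈ pa i} => x j.1) = fun j => y j.1 :=
    funext fun j => h j.1 ((Fin.lt_def.1 (hpa i _ j.2)).trans hk)
  simp only [h1, h i hk]

variable [Fintype A]

/-- If `F` depends only on the vertices below `i`, then summing `F` against a local factor at `i`
amounts to summing out the value at `i`. -/
theorem card_mul_sum_mul_local (hpa : ∀ i, ∀ j ∈ pa i, j < i) (i : Fin n)
    (g : ({j // j ∈ pa i} → A) → A → ℝ) (F : (Fin n → A) → ℝ)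
    (hF : DependsOn F {j | j.val < i.val}) :
    Fintype.card A * ∑ x, F x * g (fun j => x j.1) (x i)
      = ∑ x, F x * ∑ s, g (fun j => x j.1) s := by
  rw [← sum_sum_update i]
  refine sum_congr rfl fun x _ => ?_
  rw [mul_sum]
  refine sum_congr rfl fun s _ => ?_
  have h1 : F (Function.update x i s) = F x :=
    hF fun j hj => Function.update_of_ne (Fin.ne_of_lt hj) _ _
  have h2 : (fun j : {j // j ∈ pa i} => Function.update x i s j.1) = fun j => x j.1 :=
    funext fun j => Function.update_of_ne (hpa i _ j.2).ne _ _
  rw [h1, h2, Function.update_self]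

/-- The conditional distributions of the vertices from `k` on integrate to one. -/
theorem card_pow_mul_sum_mul_prod (hpa : ∀ i, ∀ j ∈ pa i, j < i)
    (p : (i : Fin n) → ({j // j ∈ pa i} → A) → A → ℝ) (hp1 : ∀ i a, ∑ s, p i a s = 1)
    (m k : ℕ) (hkm : k + m = n) (F : (Fin n → A) → ℝ) (hF : DependsOn F {j | j.val < k}) :
    (Fintype.card A : ℝ) ^ m *
        ∑ x, F x * ∏ i with k ≤ i.val, p i (fun j => x j.1) (x i)
      = ∑ x, F x := by
  induction m generalizing k F with
  | zero =>
    have h : (univ.filter fun i : Fin n => k ≤ i.val) = ∅ :=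
      filter_eq_empty_iff.2 fun i _ => by omega
    simp [h]
  | succ m ih =>
    let v : Fin n := ⟨k, by omega⟩
    have hsplit : (univ.filter fun i : Fin n => k ≤ i.val)
        = insert v (univ.filter fun i : Fin n => k + 1 ≤ i.val) := by
      ext i
      simp only [mem_filter, mem_univ, true_and, mem_insert, Fin.ext_iff, v]
      omega
    have hv : v ∉ univ.filter fun i : Fin n => k + 1 ≤ i.val := by simp [v]
    have hF' : DependsOn (fun x => F x * p v (fun j => x j.1) (x v)) {j | j.val < k + 1} := by
      intro x y h
      have h1 : F x = F y := hF fun j hj => h j (Nat.lt_succ_of_lt hj)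
      have h2 := dependsOn_local hpa v (p v) (Nat.lt_succ_self k) h
      simp only at h2 ⊢
      rw [h1, h2]
    have hstep := ih (k + 1) (by omega) _ hF'
    simp only [hsplit, prod_insert hv, ← mul_assoc]
    rw [pow_succ', mul_assoc, hstep, card_mul_sum_mul_local hpa v (p v) F hF]
    simp [hp1]

/-- Conditioning on the parents of `i`, the value at `i` is distributed according to `p i`. -/
theorem sum_prod_mul_local [Nonempty A] (hpa : ∀ i, ∀ j ∈ pa i, j < i)
    (p : (i : Fin n) → ({j // j ∈ pa i} → A) → A → ℝ) (hp1 : ∀ i a, ∑ s, p i a s = 1)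
    (i : Fin n) (g : ({j // j ∈ pa i} → A) → A → ℝ) :
    ∑ x : Fin n → A, (∏ k, p k (fun j => x j.1) (x k)) * g (fun j => x j.1) (x i)
      = ∑ x : Fin n → A, (∏ k, p k (fun j => x j.1) (x k)) *
          ∑ s, p i (fun j => x j.1) s * g (fun j => x j.1) s := by
  have hcard : (Fintype.card A : ℝ) ≠ 0 := Nat.cast_ne_zero.2 Fintype.card_ne_zero
  set L : (Fin n → A) → ℝ := fun x => ∏ k with k.val < i.val, p k (fun j => x j.1) (x k) with hL
  have hLdep : DependsOn L {j | j.val < i.val} := fun x y h =>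
    prod_congr rfl fun k hk => dependsOn_local hpa k (p k) (mem_filter.1 hk).2 h
  have hsplit (x : Fin n → A) : ∏ k, p k (fun j => x j.1) (x k)
      = L x * ∏ k with i.val ≤ k.val, p k (fun j => x j.1) (x k) := by
    rw [← prod_filter_mul_prod_filter_not univ fun k : Fin n => k.val < i.val]
    simp only [not_lt, hL]
  have hsplit' (x : Fin n → A) : ∏ k, p k (fun j => x j.1) (x k)
      = L x * p i (fun j => x j.1) (x i) *
        ∏ k with i.val + 1 ≤ k.val, p k (fun j => x j.1) (x k) := by
    have hset : (univ.filter fun k : Fin n => i.val ≤ k.val)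
        = insert i (univ.filter fun k : Fin n => i.val + 1 ≤ k.val) := by
      ext k
      simp only [mem_filter, mem_univ, true_and, mem_insert, Fin.ext_iff]
      omega
    rw [hsplit, hset, prod_insert (by simp), mul_assoc]
  obtain ⟨m, hm⟩ : ∃ m, i.val + 1 + m = n := ⟨n - (i.val + 1), by omega⟩
  apply mul_left_cancel₀ (pow_ne_zero (m + 1) hcard)
  have hlhs := card_pow_mul_sum_mul_prod hpa p hp1 m (i.val + 1) hm
    (fun x => L x * (p i (fun j => x j.1) (x i) * g (fun j => x j.1) (x i))) (by
      intro x y h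
      have h1 : L x = L y := hLdep fun j hj => h j (Nat.lt_succ_of_lt hj)
      have h2 := dependsOn_local hpa i (fun a s => p i a s * g a s) (Nat.lt_succ_self _) h
      simp only at h2 ⊢
      rw [h1, h2])
  have hrhs := card_pow_mul_sum_mul_prod hpa p hp1 (m + 1) i.val (by omega)
    (fun x => L x * ∑ s, p i (fun j => x j.1) s * g (fun j => x j.1) s) (by
      intro x y h
      have h1 : L x = L y := hLdep h
      have h2 : (fun j : {j // j ∈ pa i} => x j.1) = fun j => y j.1 :=
        funext fun j => h _ (hpa i _ j.2)
      simp only [h1, h2])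
  calc (Fintype.card A : ℝ) ^ (m + 1) *
        ∑ x : Fin n → A, (∏ k, p k (fun j => x j.1) (x k)) * g (fun j => x j.1) (x i)
      = Fintype.card A *
          ∑ x, L x * (p i (fun j => x j.1) (x i) * g (fun j => x j.1) (x i)) := by
        rw [← hlhs, pow_succ', mul_assoc]
        congr 2
        refine sum_congr rfl fun x _ => ?_
        rw [hsplit' x]
        ring
    _ = ∑ x, L x * ∑ s, p i (fun j => x j.1) s * g (fun j => x j.1) s :=
        card_mul_sum_mul_local hpa i (fun a s => p i a s * g a s) L hLdep
    _ = _ := by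
        rw [← hrhs]
        congr 1
        refine sum_congr rfl fun x _ => ?_
        rw [hsplit x]
        ring

end BayesNet

/-- The logarithm of a ratio of products, weighted by the numerator, is additive. -/
theorem prod_mul_log_prod_div_prod {ι : Type*} [Fintype ι] (u v : ι → ℝ) (hv : ∀ i, v i ≠ 0) :
    (∏ i, u i) * Real.log ((∏ i, u i) / ∏ i, v i)
      = ∑ i, (∏ k, u k) * Real.log (u i / v i) := by
  by_cases h : ∏ i, u i = 0
  · simp [h]
  · rw [← prod_div_distrib, Real.log_prod fun i hi =>
      div_ne_zero (prod_ne_zero_iff.1 h i hi) (hv i), mul_sum]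

/-- KL divergence between two Bayesian networks over the same DAG structure decomposes as
a sum, over vertices `i` and parent assignments `a`, of the probability (under `P`) of the
parent assignment times the KL divergence of the local conditional distributions. -/
theorem bayes_net_kl_decomposition {n : ℕ} {A : Type*} [Fintype A] [Nonempty A]
    [DecidableEq A]
    (pa : Fin n → Finset (Fin n))
    (hpa : ∀ i, ∀ j ∈ pa i, j < i)
    (p q : (i : Fin n) → ({j // j ∈ pa i} → A) → A → ℝ)
    (hp0 : ∀ i a s, 0 ≤ p i a s) (hp1 : ∀ i a, ∑ s, p i a s = 1)
    (hq0 : ∀ i a s, 0 < q i a s) (hq1 : ∀ i a, ∑ s, q i a s = 1) :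
    ∑ x : Fin n → A,
        (∏ i, p i (fun j => x j.1) (x i)) *
          Real.log ((∏ i, p i (fun j => x j.1) (x i)) / (∏ i, q i (fun j => x j.1) (x i)))
      = ∑ i, ∑ a : {j // j ∈ pa i} → A,
          (∑ x ∈ Finset.univ.filter
              (fun x : Fin n → A => ∀ j : {j // j ∈ pa i}, x j.1 = a j),
            ∏ k, p k (fun j => x j.1) (x k))
          * ∑ s, p i a s * Real.log (p i a s / q i a s) := by
  simp only [prod_mul_log_prod_div_prod _ _ fun i => (hq0 i _ _).ne']
  rw [sum_comm]
  refine sum_congr rfl fun i _ => ?_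
  rw [sum_prod_mul_local hpa p hp1 i fun a s => Real.log (p i a s / q i a s),
    ← sum_fiberwise univ fun (x : Fin n → A) (j : {j // j ∈ pa i}) => x j.1]
  refine sum_congr rfl fun a _ => ?_
  simp only [funext_iff, sum_mul]
  refine sum_congr rfl fun x hx => ?_
  rw [funext (mem_filter.1 hx).2]
end
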